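/- For all real numbers β ≥ 0 and d ≥ 0, and all real s, s' with -d ≤ s ≤ d and -d ≤ s' ≤ d, one has |e^{βs}/(e^{βs} + e^{-βs}) − e^{βs'}/(e^{βs'} + e^{-βs'})| ≤ tanh(β d). -/

import Mathlib

theorem monotone_exp_div_exp_add_exp_neg :
    Monotone fun x : ℝ => Real.exp x / (Real.exp x + Real.exp (-x)) := by
  intro x y hxy
  have hcross : Real.exp x * Real.exp (-y) ≤ Real.exp y * Real.exp (-x) :=
    mul_le_mul (Real.exp_le_exp.2 hxy) (Real.exp_le_exp.2 (neg_le_neg hxy))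
      (Real.exp_pos _).le (Real.exp_pos _).le
  change _ / _ ≤ _ / _
  rw [div_le_div_iff₀ (by positivity) (by positivity)]
  linarith

theorem exp_div_sub_exp_neg_div_eq_tanh (x : ℝ) :
    Real.exp x / (Real.exp x + Real.exp (-x))
      - Real.exp (-x) / (Real.exp (-x) + Real.exp (- -x)) = Real.tanh x := by
  rw [neg_neg, add_comm (Real.exp (-x)), ← sub_div, Real.tanh_eq_sinh_div_cosh,
    Real.sinh_eq, Real.cosh_eq, div_div_div_cancel_right₀ two_ne_zero]

/-- The total variation bound for single-site Ising conditional distributions: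
for `β ≥ 0`, `d ≥ 0` and `s, s' ∈ [-d, d]`,
`|e^{βs}/(e^{βs}+e^{-βs}) − e^{βs'}/(e^{βs'}+e^{-βs'})| ≤ tanh(β d)`. -/
theorem stmt_12 (β d : ℝ) (hβ : 0 ≤ β) (hd : 0 ≤ d)
    (s s' : ℝ) (hs : -d ≤ s) (hs' : s ≤ d) (ht : -d ≤ s') (ht' : s' ≤ d) :
    |Real.exp (β * s) / (Real.exp (β * s) + Real.exp (-(β * s)))
      - Real.exp (β * s') / (Real.exp (β * s') + Real.exp (-(β * s')))|
      ≤ Real.tanh (β * d) := by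
  have hbounds {t : ℝ} (hl : -d ≤ t) (hu : t ≤ d) : -(β * d) ≤ β * t ∧ β * t ≤ β * d :=
    ⟨by simpa using mul_le_mul_of_nonneg_left hl hβ, mul_le_mul_of_nonneg_left hu hβ⟩
  obtain ⟨hsl, hsu⟩ := hbounds hs hs'
  obtain ⟨htl, htu⟩ := hbounds ht ht'
  rw [← exp_div_sub_exp_neg_div_eq_tanh]
  exact abs_sub_le_of_le_of_le
    (monotone_exp_div_exp_add_exp_neg hsl) (monotone_exp_div_exp_add_exp_neg hsu)
    (monotone_exp_div_exp_add_exp_neg htl) (monotone_exp_div_exp_add_exp_neg htu)
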